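/- (Hopf lemma) Let A, B, C be finite-dimensional complex vector spaces and φ : A × B → C a bilinear map such that for every nonzero a ∈ A the linear map φ(a,·) : B → C is injective, and for every nonzero b ∈ B the linear map φ(·,b) : A → C is injective. If A and B are nonzero, then the linear span of the image of φ has dimension at least dim A + dim B − 1. -/

import Mathlib

open Module

section HopfAux
open MvPolynomial

lemma hopf_aux_integral {m n c : ℕ} (hm : 0 < m) (hn : 0 < n)
    (T : Fin c → Fin m → Fin n → ℂ)
    (h : ∀ (a : Fin m → ℂ) (b : Fin n → ℂ),
      (∀ k, ∑ i, ∑ j, T k i j * (a i * b j) = 0) → a = 0 ∨ b = 0)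
    {K : Type} [Field K] [Algebra ℂ K] (x : Fin m → K) (y : Fin n → K)
    (hx : ∀ i, x i ≠ 0) (hy : ∀ j, y j ≠ 0) (V : ValuationSubring K)
    (hC : ∀ z : ℂ, algebraMap ℂ K z ∈ V)
    (hF : ∀ k, ∑ i, ∑ j, algebraMap ℂ K (T k i j) * (x i * y j) ∈ V) (i : Fin m) (j : Fin n) :
    x i * y j ∈ V := by
  have : Nonempty (Fin m) := ⟨⟨0, hm⟩⟩
  have : Nonempty (Fin n) := ⟨⟨0, hn⟩⟩
  obtain ⟨i0, hi0⟩ := Finite.exists_max (fun i => V.valuation (x i))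
  obtain ⟨j0, hj0⟩ := Finite.exists_max (fun j => V.valuation (y j))
  suffices hh : V.valuation (x i0 * y j0) ≤ 1 by
    rw [← V.valuation_le_one_iff]
    refine le_trans ?_ hh
    rw [map_mul, map_mul]
    exact mul_le_mul' (hi0 i) (hj0 j)
  by_contra hlt
  rw [not_le] at hlt
  let u : Fin m ⊕ Fin n → K := Sum.elim (fun i => x i / x i0) (fun j => y j / y j0)
  have hu : ∀ s, u s ∈ V := by
    intro s
    rw [← V.valuation_le_one_iff]
    rcases s with s | s
    · simp only [u, Sum.elim_inl, map_div₀]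
      exact div_le_one_of_le₀ (hi0 s) zero_le
    · simp only [u, Sum.elim_inr, map_div₀]
      exact div_le_one_of_le₀ (hj0 s) zero_le
  have hint : ∀ q : MvPolynomial (Fin m ⊕ Fin n) ℂ, aeval u q ∈ V := by
    intro q
    induction q using MvPolynomial.induction_on with
    | C a => simpa using hC a
    | add p q hp hq => rw [map_add]; exact V.add_mem _ _ hp hq
    | mul_X p s hp => rw [map_mul, aeval_X]; exact V.mul_mem _ _ hp (hu s)
  let F : Fin c → MvPolynomial (Fin m ⊕ Fin n) ℂ := fun k =>
    ∑ i, ∑ j, C (T k i j) * (X (Sum.inl i) * X (Sum.inr j))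
  have hFlt : ∀ k, V.valuation (aeval u (F k)) < 1 := by
    intro k
    have e : aeval u (F k) =
        (∑ i, ∑ j, algebraMap ℂ K (T k i j) * (x i * y j)) / (x i0 * y j0) := by
      simp only [F, map_sum, map_mul, aeval_X, u, Sum.elim_inl, Sum.elim_inr, Finset.sum_div,
        algHom_C]
      refine Finset.sum_congr rfl fun i _ => Finset.sum_congr rfl fun j _ => ?_
      have := hx i0
      have := hy j0
      field_simp
    rw [e, map_div₀]
    refine (div_lt_one₀ (zero_lt_one.trans hlt)).2 ?_
    exact lt_of_le_of_lt ((V.valuation_le_one_iff _).2 (hF k)) hlt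
  have hI : ∀ p ∈ Ideal.span (Set.range F), V.valuation (aeval u p) < 1 := by
    intro p hp
    induction hp using Submodule.span_induction with
    | mem p hp => obtain ⟨k, rfl⟩ := hp; exact hFlt k
    | zero => simp
    | add p q _ _ hp hq => rw [map_add]; exact Valuation.map_add_lt _ hp hq
    | smul a p _ hp =>
      rw [smul_eq_mul, map_mul, map_mul]
      exact lt_of_le_of_lt (mul_le_of_le_one_left' ((V.valuation_le_one_iff _).2 (hint a))) hp
  have hrad : (X (Sum.inl i0) * X (Sum.inr j0) : MvPolynomial (Fin m ⊕ Fin n) ℂ) ∈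
      (Ideal.span (Set.range F)).radical := by
    rw [← vanishingIdeal_zeroLocus_eq_radical (K := ℂ)]
    rw [mem_vanishingIdeal_iff]
    intro w hw
    have := h (fun i => w (Sum.inl i)) (fun j => w (Sum.inr j)) (by
      intro k
      have := hw (F k) (Ideal.subset_span ⟨k, rfl⟩)
      simpa [F] using this)
    rw [map_mul, aeval_X, aeval_X]
    rcases this with h0 | h0
    · rw [congrFun h0 i0]; simp
    · rw [congrFun h0 j0]; simp
  obtain ⟨N, hN⟩ := hrad
  have := hI _ hN
  simp [u, hx i0, hy j0] at this

lemma hopf_aux {m n c : ℕ} (hm : 0 < m) (hn : 0 < n)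
    (T : Fin c → Fin m → Fin n → ℂ)
    (h : ∀ (a : Fin m → ℂ) (b : Fin n → ℂ),
      (∀ k, ∑ i, ∑ j, T k i j * (a i * b j) = 0) → a = 0 ∨ b = 0) : m + n ≤ c + 1 := by
  let P := MvPolynomial (Fin m ⊕ Fin n) ℂ
  let K := FractionRing P
  let x : Fin m → K := fun i => algebraMap P K (X (Sum.inl i))
  let y : Fin n → K := fun i => algebraMap P K (X (Sum.inr i))
  have hinj : Function.Injective (algebraMap P K) := IsFractionRing.injective P K
  have hx : ∀ i, x i ≠ 0 := fun i => by
    simp only [x]; rw [Ne, map_eq_zero_iff _ hinj]; exact X_ne_zero _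
  have hy : ∀ i, y i ≠ 0 := fun i => by
    simp only [y]; rw [Ne, map_eq_zero_iff _ hinj]; exact X_ne_zero _
  let f : Fin c → K := fun k => ∑ i, ∑ j, algebraMap ℂ K (T k i j) * (x i * y j)
  let i0 : Fin m := ⟨0, hm⟩
  let j0 : Fin n := ⟨0, hn⟩
  let t : Set K := insert (x i0) (Set.range f)
  let s : Set K := Set.range (algebraMap ℂ K) ∪ Set.range f
  let R := Algebra.adjoin ℂ t
  have hle : Subring.closure s ≤ R.toSubring := by
    rw [Subring.closure_le]
    rintro _ (⟨z, rfl⟩ | ⟨k, rfl⟩)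
    · exact R.algebraMap_mem z
    · exact Algebra.subset_adjoin (Set.mem_insert_of_mem _ ⟨k, rfl⟩)
  have hxy : ∀ i j, IsAlgebraic R (x i * y j) := by
    intro i j
    have h1 : x i * y j ∈ (integralClosure (Subring.closure s) K).toSubring := by
      rw [← iInf_valuationSubring_superset, Subring.mem_iInf]
      rintro ⟨V, hV⟩
      exact hopf_aux_integral hm hn T h x y hx hy V (fun z => hV (Or.inl ⟨z, rfl⟩))
        (fun k => hV (Or.inr ⟨k, rfl⟩)) i j
    obtain ⟨p, hp, hp0⟩ : IsIntegral (Subring.closure s) (x i * y j) := h1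
    have : IsIntegral R (x i * y j) := by
      refine ⟨p.map (Subring.inclusion hle), hp.map _, ?_⟩
      rw [Polynomial.eval₂_map]
      exact hp0
    exact this.isAlgebraic
  have hx0 : IsAlgebraic R (x i0) :=
    isAlgebraic_algebraMap (⟨x i0, Algebra.subset_adjoin (Set.mem_insert _ _)⟩ : R)
  have hya : ∀ j, IsAlgebraic R (y j) := by
    intro j
    have : y j = (x i0)⁻¹ * (x i0 * y j) := by rw [inv_mul_cancel_left₀ (hx i0)]
    rw [this]
    exact hx0.inv.mul (hxy _ _)
  have hxa : ∀ i, IsAlgebraic R (x i) := by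
    intro i
    have : x i = (x i * y j0) * (y j0)⁻¹ := by rw [mul_inv_cancel_right₀ (hy j0)]
    rw [this]
    exact (hxy _ _).mul (hya j0).inv
  have hPa : ∀ p : P, IsAlgebraic R (algebraMap P K p) := by
    intro p
    induction p using MvPolynomial.induction_on with
    | C a =>
      exact isAlgebraic_algebraMap (⟨algebraMap ℂ K a, R.algebraMap_mem a⟩ : R)
    | add p q hp hq => rw [map_add]; exact hp.add hq
    | mul_X p s hp =>
      rw [map_mul]
      refine hp.mul ?_
      rcases s with s | s
      · exact hxa s
      · exact hya s
  have : Algebra.IsAlgebraic R K := ⟨fun z => by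
    obtain ⟨p, q, _, rfl⟩ := IsFractionRing.div_surjective (A := P) z
    rw [div_eq_mul_inv]
    exact (hPa p).mul (hPa q).inv⟩
  have h1 : Algebra.trdeg ℂ K ≤ Cardinal.mk t :=
    Algebra.IsAlgebraic.trdeg_le_cardinalMk ℂ t
  have h2 : Algebra.trdeg ℂ P ≤ Algebra.trdeg ℂ K :=
    trdeg_le_of_injective (IsScalarTower.toAlgHom ℂ P K) hinj
  have h3 : Algebra.trdeg ℂ P = ((m + n : ℕ) : Cardinal) := by
    rw [MvPolynomial.trdeg_of_isDomain]; simp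
  have h4 : Cardinal.mk t ≤ ((c + 1 : ℕ) : Cardinal) := by
    refine Cardinal.mk_insert_le.trans ?_
    push_cast
    gcongr
    exact Cardinal.mk_range_le.trans (by simp)
  have h5 := h3.symm.le.trans (h2.trans (h1.trans h4))
  exact_mod_cast h5

end HopfAux

/-- Hopf lemma: if φ : A × B → C is bilinear, injective in each variable separately
(for nonzero fixed other variable), and A, B are nonzero, then the span of the image
of φ has dimension at least dim A + dim B − 1. -/
theorem stmt_2 (A B C : Type*) [AddCommGroup A] [Module ℂ A] [FiniteDimensional ℂ A]
    [AddCommGroup B] [Module ℂ B] [FiniteDimensional ℂ B]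
    [AddCommGroup C] [Module ℂ C] [FiniteDimensional ℂ C]
    (φ : A →ₗ[ℂ] B →ₗ[ℂ] C)
    (hA : ∀ a : A, a ≠ 0 → Function.Injective (φ a))
    (hB : ∀ b : B, b ≠ 0 → Function.Injective (fun a : A => φ a b))
    (hAne : Nontrivial A) (hBne : Nontrivial B) :
    finrank ℂ A + finrank ℂ B - 1 ≤
      finrank ℂ (Submodule.span ℂ (Set.range (fun p : A × B => φ p.1 p.2))) := by
  set S := Submodule.span ℂ (Set.range (fun p : A × B => φ p.1 p.2)) with hS
  have hmem : ∀ a b, φ a b ∈ S := fun a b => Submodule.subset_span ⟨(a, b), rfl⟩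
  let bA := finBasis ℂ A
  let bB := finBasis ℂ B
  let bS := finBasis ℂ S
  have := hopf_aux (m := finrank ℂ A) (n := finrank ℂ B) (c := finrank ℂ S)
    finrank_pos finrank_pos (fun k i j => bS.repr ⟨φ (bA i) (bB j), hmem _ _⟩ k) (by
      intro a b hab
      have key : φ (∑ i, a i • bA i) (∑ j, b j • bB j) = 0 := by
        have e : (∑ i, ∑ j, (a i * b j) • (⟨φ (bA i) (bB j), hmem _ _⟩ : S)) = 0 := by
          apply bS.repr.injective
          ext k
          refine Eq.trans ?_ ((hab k).trans (by simp))
          simp only [map_sum, map_smul, Finsupp.finsetSum_apply, Finsupp.smul_apply, smul_eq_mul]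
          refine Finset.sum_congr rfl fun i _ => Finset.sum_congr rfl fun j _ => ?_
          rw [mul_comm]
        have e2 := congrArg (Submodule.subtype S) e
        simp only [map_sum, map_smul, Submodule.subtype_apply, map_zero] at e2
        rw [← e2]
        simp only [map_sum, LinearMap.sum_apply, map_smul, LinearMap.smul_apply, Finset.smul_sum,
          mul_smul]
        refine Finset.sum_comm.trans ?_
        refine Finset.sum_congr rfl fun i _ => Finset.sum_congr rfl fun j _ => ?_
        first | rfl | rw [smul_comm]
      by_cases h0 : ∑ i, a i • bA i = 0
      · left
        ext i
        exact Fintype.linearIndependent_iff.1 bA.linearIndependent a h0 i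
      · right
        have h1 : ∑ j, b j • bB j = 0 := hA _ h0 (by rw [key, map_zero])
        ext j
        exact Fintype.linearIndependent_iff.1 bB.linearIndependent b h1 j)
  omega
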